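/- Let D = {x ∈ ℝ² : 2 ≤ ‖x‖ ≤ R}, R ∈ (2,4], and let A ⊂ D be compact with diam(A) ≤ 2. Then the circular symmetrization A^st also satisfies diam(A^st) ≤ 2 and λ₂(A^st) = λ₂(A). -/

import Mathlib

open MeasureTheory

/-- Circular (Pólya) symmetrization of a subset of the annulus with inner radius 2
and outer radius `R`. -/
def circSym (R : ℝ) (K : Set (EuclideanSpace ℝ (Fin 2))) :
    Set (EuclideanSpace ℝ (Fin 2)) :=
  {p | ∃ r α : ℝ, r ∈ Set.Icc 2 R ∧ (K ∩ Metric.sphere 0 r).Nonempty ∧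
    ENNReal.ofReal (2 * r * |α|) ≤
      (MeasureTheory.Measure.hausdorffMeasure 1 :
        Measure (EuclideanSpace ℝ (Fin 2))) (K ∩ Metric.sphere 0 r) ∧
    p 0 = r * Real.cos α ∧ p 1 = r * Real.sin α}

/-- The point of the plane with polar coordinates `(r, θ)`. -/
noncomputable def polarPoint (r θ : ℝ) : EuclideanSpace ℝ (Fin 2) :=
  !₂[r * Real.cos θ, r * Real.sin θ]

lemma dist_polarPoint_sq (r s α β : ℝ) :
    dist (polarPoint r α) (polarPoint s β) ^ 2 =
      r ^ 2 + s ^ 2 - 2 * r * s * Real.cos (α - β) := by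
  rw [EuclideanSpace.dist_sq_eq]
  simp only [polarPoint, Fin.sum_univ_two, Real.dist_eq, sq_abs, Real.cos_sub,
    Matrix.cons_val_zero, Matrix.cons_val_one]
  linear_combination r ^ 2 * Real.sin_sq_add_cos_sq α + s ^ 2 * Real.sin_sq_add_cos_sq β

lemma norm_polarPoint {r : ℝ} (hr : 0 ≤ r) (θ : ℝ) : ‖polarPoint r θ‖ = r := by
  rw [← sq_eq_sq₀ (norm_nonneg _) hr, EuclideanSpace.norm_sq_eq]
  simp only [polarPoint, Fin.sum_univ_two, Real.norm_eq_abs, sq_abs,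
    Matrix.cons_val_zero, Matrix.cons_val_one]
  linear_combination r ^ 2 * Real.sin_sq_add_cos_sq θ

lemma continuous_polarPoint : Continuous fun q : ℝ × ℝ => polarPoint q.1 q.2 := by
  unfold polarPoint
  refine (PiLp.continuous_toLp 2 _).comp (continuous_pi fun i => ?_)
  fin_cases i <;> simp <;> fun_prop

lemma polarPoint_sub_int_mul_two_pi (r θ : ℝ) (n : ℤ) :
    polarPoint r (θ - n * (2 * Real.pi)) = polarPoint r θ := by
  simp [polarPoint, Real.cos_sub_int_mul_two_pi, Real.sin_sub_int_mul_two_pi]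

/-- The polar angle of a point of the plane, in `(-π, π]`. -/
noncomputable def planeArg (x : EuclideanSpace ℝ (Fin 2)) : ℝ :=
  Complex.arg ⟨x 0, x 1⟩

lemma planeArg_mem_Ioc (x : EuclideanSpace ℝ (Fin 2)) :
    planeArg x ∈ Set.Ioc (-Real.pi) Real.pi :=
  Complex.arg_mem_Ioc _

lemma measurable_planeArg : Measurable planeArg := by
  have h : Continuous fun x : EuclideanSpace ℝ (Fin 2) => (x 0 : ℂ) + (x 1 : ℂ) * Complex.I := by
    fun_prop
  convert Complex.measurable_arg.comp h.measurable using 1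
  ext x
  simp [planeArg, Complex.mk_eq_add_mul_I]

lemma polarPoint_norm_planeArg (x : EuclideanSpace ℝ (Fin 2)) :
    polarPoint ‖x‖ (planeArg x) = x := by
  have hn : ‖x‖ = ‖(⟨x 0, x 1⟩ : ℂ)‖ := by
    rw [← sq_eq_sq₀ (norm_nonneg _) (norm_nonneg _), EuclideanSpace.norm_sq_eq,
      Complex.sq_norm, Complex.normSq_apply]
    simp [Fin.sum_univ_two, pow_two]
  ext i
  fin_cases i
  · simp [polarPoint, planeArg, hn]
  · simp [polarPoint, planeArg, hn]

lemma planeArg_polarPoint {r θ : ℝ} (hr : 0 < r) (hθ : θ ∈ Set.Ioc (-Real.pi) Real.pi) :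
    planeArg (polarPoint r θ) = θ := by
  refine Eq.trans ?_ (Complex.arg_mul_cos_add_sin_mul_I hr hθ)
  rw [planeArg]
  congr 1
  apply Complex.ext
  · simp [polarPoint, ← Complex.ofReal_cos, ← Complex.ofReal_sin]
  · simp [polarPoint, ← Complex.ofReal_cos, ← Complex.ofReal_sin]

lemma abs_planeArg_polarPoint_le {r : ℝ} (hr : 0 < r) (α : ℝ) :
    |planeArg (polarPoint r α)| ≤ |α| := by
  rcases lt_or_ge |α| Real.pi with h | h
  · rw [abs_lt] at h
    rw [planeArg_polarPoint hr ⟨h.1, h.2.le⟩]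
  · have := planeArg_mem_Ioc (polarPoint r α)
    exact (abs_le.2 ⟨this.1.le, this.2⟩).trans h

lemma injOn_polarPoint {r : ℝ} (hr : 0 < r) :
    Set.InjOn (polarPoint r) (Set.Ioc (-Real.pi) Real.pi) := fun a ha b hb h => by
  rw [← planeArg_polarPoint hr ha, h, planeArg_polarPoint hr hb]

lemma dist_polarPoint_eq_sin {r : ℝ} (hr : 0 ≤ r) (α β : ℝ) :
    dist (polarPoint r α) (polarPoint r β) = 2 * r * |Real.sin ((α - β) / 2)| := by
  rw [← sq_eq_sq₀ dist_nonneg (by positivity), dist_polarPoint_sq, mul_pow, sq_abs]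
  have h := Real.cos_two_mul ((α - β) / 2)
  rw [mul_div_cancel₀ _ (two_ne_zero' ℝ)] at h
  rw [h]
  linear_combination (-4 * r ^ 2) * Real.sin_sq_add_cos_sq ((α - β) / 2)

lemma lipschitzWith_polarPoint (r : NNReal) : LipschitzWith r (polarPoint r) := by
  refine LipschitzWith.of_dist_le_mul fun α β => ?_
  rw [dist_polarPoint_eq_sin r.coe_nonneg, Real.dist_eq]
  have h := Real.abs_sin_le_abs (x := (α - β) / 2)
  rw [abs_div, abs_two] at h
  nlinarith [mul_le_mul_of_nonneg_left h r.coe_nonneg]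

/-- On short arcs chords are comparable with arc length. -/
lemma mul_abs_sub_le_dist_polarPoint {r c : ℝ} (hr : 0 ≤ r) (hc : 0 ≤ c) {α β : ℝ}
    (h : |α - β| ≤ 2 * (1 - c)) :
    c * r * |α - β| ≤ dist (polarPoint r α) (polarPoint r β) := by
  rw [dist_polarPoint_eq_sin hr]
  set x := |α - β| / 2 with hx
  have hx0 : 0 ≤ x := by positivity
  have hxc : x ≤ 1 - c := by linarith
  have h1 : x - x ^ 3 / 6 ≤ |Real.sin ((α - β) / 2)| := by
    have h2 : |Real.sin x| = |Real.sin ((α - β) / 2)| := by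
      rcases abs_choice (α - β) with h | h <;> simp [hx, h]
      rw [← abs_neg, ← Real.sin_neg]
      ring_nf
    rw [← h2]
    rcases hx0.eq_or_lt with h0 | h0
    · simp [← h0]
    · exact (Real.sin_gt_sub_cube h0).le.trans (le_abs_self _)
  have h3 : c * x ≤ x - x ^ 3 / 6 := by
    nlinarith [mul_nonneg hx0 (sub_nonneg.2 hxc), mul_nonneg hx0 hx0,
      mul_nonneg (mul_nonneg hx0 hx0) (by linarith : 0 ≤ 1 - x)]
  have h4 : |α - β| = 2 * x := by rw [hx]; ring
  rw [h4]
  nlinarith [mul_le_mul_of_nonneg_left (h3.trans h1) hr]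

lemma ofReal_mul_volume_le_hausdorffMeasure_image {r c : ℝ} (hr : 0 < r) (hc : 0 < c) {S : Set ℝ}
    (hS : ∀ α ∈ S, ∀ β ∈ S, |α - β| ≤ 2 * (1 - c)) :
    ENNReal.ofReal (c * r) * volume S ≤
      (Measure.hausdorffMeasure 1 : Measure (EuclideanSpace ℝ (Fin 2))) (polarPoint r '' S) := by
  have hcr : 0 < c * r := by positivity
  have hd : ∀ α ∈ S, ∀ β ∈ S, c * r * |α - β| ≤ dist (polarPoint r α) (polarPoint r β) :=
    fun α hα β hβ => mul_abs_sub_le_dist_polarPoint hr.le hc.le (hS α hα β hβ)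
  have hinj : Set.InjOn (polarPoint r) S := fun α hα β hβ h => by
    have h1 := hd α hα β hβ
    rw [h, dist_self] at h1
    have h2 : |α - β| ≤ 0 := by
      by_contra! h3
      exact absurd h1 (not_le.2 (mul_pos hcr h3))
    exact sub_eq_zero.1 (abs_nonpos_iff.1 h2)
  have hlip : LipschitzOnWith (Real.toNNReal (c * r))⁻¹ (Function.invFunOn (polarPoint r) S)
      (polarPoint r '' S) := by
    refine LipschitzOnWith.of_dist_le_mul ?_
    rintro _ ⟨α, hα, rfl⟩ _ ⟨β, hβ, rfl⟩
    rw [hinj.leftInvOn_invFunOn hα, hinj.leftInvOn_invFunOn hβ, Real.dist_eq, NNReal.coe_inv,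
      Real.coe_toNNReal _ hcr.le, ← div_eq_inv_mul, le_div_iff₀' hcr]
    exact hd α hα β hβ
  have h := hlip.hausdorffMeasure_image_le zero_le_one
  have hK : Real.toNNReal (c * r) ≠ 0 := (Real.toNNReal_pos.2 hcr).ne'
  rw [hinj.leftInvOn_invFunOn.image_image, hausdorffMeasure_real, ENNReal.rpow_one,
    ENNReal.coe_inv hK, mul_comm, ← div_eq_mul_inv] at h
  rw [mul_comm]
  exact ENNReal.mul_le_of_le_div h

lemma ofReal_mul_volume_le_hausdorffMeasure_image_of_injOn {r : ℝ} (hr : 0 < r) {T : Set ℝ}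
    (hT : MeasurableSet T) (hinj : Set.InjOn (polarPoint r) T) :
    ENNReal.ofReal r * volume T ≤
      (Measure.hausdorffMeasure 1 : Measure (EuclideanSpace ℝ (Fin 2))) (polarPoint r '' T) := by
  have hcont : Continuous (polarPoint r) := 
    continuous_polarPoint.comp (Continuous.prodMk_right r)
  have key : ∀ c ∈ Set.Ioo (0 : ℝ) 1, ENNReal.ofReal (c * r) * volume T ≤
      (Measure.hausdorffMeasure 1 : Measure (EuclideanSpace ℝ (Fin 2))) (polarPoint r '' T) := by
    intro c hc
    have hδ : 0 < 2 * (1 - c) := by linarith [hc.2]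
    set piece : ℤ → Set ℝ := fun k => T ∩ {t | ⌊t / (2 * (1 - c))⌋ = k} with hpiece
    have hunion : T = ⋃ k, piece k := by
      ext t
      simp [hpiece]
    have hmeas : ∀ k, MeasurableSet (piece k) := fun k =>
      hT.inter ((Int.measurable_floor.comp (measurable_id.div_const _))
        (measurableSet_singleton k))
    have hdisj : Pairwise (Function.onFun Disjoint piece) := fun i j hij =>
      Set.disjoint_left.2 fun t hi hj => hij (hi.2.symm.trans hj.2)
    have hshort : ∀ k, ∀ α ∈ piece k, ∀ β ∈ piece k, |α - β| ≤ 2 * (1 - c) := by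
      intro k α hα β hβ
      have h := Int.abs_sub_lt_one_of_floor_eq_floor (hα.2.trans hβ.2.symm)
      rw [← sub_div, abs_div, abs_of_pos hδ, div_lt_one hδ] at h
      exact h.le
    calc ENNReal.ofReal (c * r) * volume T
        = ∑' k, ENNReal.ofReal (c * r) * volume (piece k) := by
          rw [ENNReal.tsum_mul_left, ← measure_iUnion hdisj hmeas, ← hunion]
      _ ≤ ∑' k, (Measure.hausdorffMeasure 1 : Measure (EuclideanSpace ℝ (Fin 2)))
            (polarPoint r '' piece k) :=
          ENNReal.tsum_le_tsum fun k =>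
            ofReal_mul_volume_le_hausdorffMeasure_image hr hc.1 (hshort k)
      _ = (Measure.hausdorffMeasure 1 : Measure (EuclideanSpace ℝ (Fin 2)))
            (polarPoint r '' T) := by
          rw [← measure_iUnion, ← Set.image_iUnion, ← hunion]
          · intro i j hij
            exact Set.disjoint_image_image fun x hx y hy hxy =>
              Set.disjoint_left.1 (hdisj hij) hx (hinj hx.1 hy.1 hxy ▸ hy)
          · exact fun k => (hmeas k).image_of_continuousOn_injOn hcont.continuousOn
              (hinj.mono Set.inter_subset_left)
  have hlim : Filter.Tendsto (fun c : ℝ => ENNReal.ofReal (c * r) * volume T)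
      (nhdsWithin 1 (Set.Iio 1)) (nhds (ENNReal.ofReal (1 * r) * volume T)) := by
    refine ENNReal.Tendsto.mul_const ?_ (Or.inl (by simpa using hr))
    exact (ENNReal.continuous_ofReal.comp (continuous_mul_const r)).continuousWithinAt
  rw [one_mul] at hlim
  exact le_of_tendsto hlim (Filter.mem_of_superset (Ioo_mem_nhdsLT zero_lt_one) key)

lemma hausdorffMeasure_image_polarPoint_le {r : ℝ} (hr : 0 ≤ r) (T : Set ℝ) :
    (Measure.hausdorffMeasure 1 : Measure (EuclideanSpace ℝ (Fin 2))) (polarPoint r '' T) ≤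
      ENNReal.ofReal r * volume T := by
  lift r to NNReal using hr
  have h := (lipschitzWith_polarPoint r).hausdorffMeasure_image_le zero_le_one T
  rwa [ENNReal.rpow_one, hausdorffMeasure_real, ← ENNReal.ofReal_coe_nnreal] at h

/-- The angles in `(-π, π)` at which the circle of radius `r` meets `K`. -/
def angleSlice (K : Set (EuclideanSpace ℝ (Fin 2))) (r : ℝ) : Set ℝ :=
  {θ | θ ∈ Set.Ioo (-Real.pi) Real.pi ∧ polarPoint r θ ∈ K}

lemma measurableSet_prod_angleSlice {K : Set (EuclideanSpace ℝ (Fin 2))} (hK : MeasurableSet K) :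
    MeasurableSet {q : ℝ × ℝ | q.2 ∈ angleSlice K q.1} :=
  (measurable_snd measurableSet_Ioo).inter (continuous_polarPoint.measurable hK)

lemma hausdorffMeasure_inter_sphere {K : Set (EuclideanSpace ℝ (Fin 2))} (hK : MeasurableSet K)
    {r : ℝ} (hr : 0 < r) :
    (Measure.hausdorffMeasure 1 : Measure (EuclideanSpace ℝ (Fin 2))) (K ∩ Metric.sphere 0 r) =
      ENNReal.ofReal r * volume (angleSlice K r) := by
  apply le_antisymm
  · have hsub : K ∩ Metric.sphere 0 r ⊆ polarPoint r '' (angleSlice K r ∪ {Real.pi}) := by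
      rintro x ⟨hx, hxr⟩
      rw [mem_sphere_zero_iff_norm] at hxr
      have hp := polarPoint_norm_planeArg x
      rw [hxr] at hp
      refine ⟨planeArg x, ?_, hp⟩
      rcases (planeArg_mem_Ioc x).2.eq_or_lt with h | h
      · exact Or.inr h
      · exact Or.inl ⟨⟨(planeArg_mem_Ioc x).1, h⟩, hp.symm ▸ hx⟩
    refine (measure_mono hsub).trans ((hausdorffMeasure_image_polarPoint_le hr.le _).trans ?_)
    have h := measure_union_le (μ := volume) (angleSlice K r) {Real.pi}
    rw [Real.volume_singleton, add_zero] at h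
    exact mul_le_mul_right h _
  · refine (ofReal_mul_volume_le_hausdorffMeasure_image_of_injOn hr
      (measurable_prodMk_left (measurableSet_prod_angleSlice hK)) ?_).trans (measure_mono ?_)
    · exact (injOn_polarPoint hr).mono fun θ hθ => Set.Ioo_subset_Ioc_self hθ.1
    · rintro _ ⟨θ, hθ, rfl⟩
      exact ⟨hθ.2, by rw [mem_sphere_zero_iff_norm, norm_polarPoint hr.le]⟩

/-- Area in polar coordinates. -/
lemma volume_eq_lintegral_angleSlice {K : Set (EuclideanSpace ℝ (Fin 2))} (hK : MeasurableSet K) :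
    volume K = ∫⁻ r in Set.Ioi 0, ENNReal.ofReal r * volume (angleSlice K r) := by
  let e := (MeasurableEquiv.toLp 2 (Fin 2 → ℝ)).symm.trans MeasurableEquiv.finTwoArrow
  have he : MeasurePreserving e volume volume :=
    (volume_preserving_finTwoArrow ℝ).comp
      (EuclideanSpace.volume_preserving_symm_measurableEquiv_toLp (Fin 2))
  have heK : MeasurableSet (e.symm ⁻¹' K) := e.symm.measurable hK
  have hpolar : ∀ q : ℝ × ℝ, e.symm (polarCoord.symm q) = polarPoint q.1 q.2 := fun q => by
    ext i
    fin_cases i <;> rfl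
  have hv : volume K = volume (e.symm ⁻¹' K) := by
    rw [← he.measure_preimage_equiv, ← Set.preimage_comp, e.symm_comp_self, Set.preimage_id]
  have hf : Measurable fun q : ℝ × ℝ =>
      (e.symm ⁻¹' K).indicator (1 : ℝ × ℝ → ENNReal) (polarCoord.symm q) :=
    (measurable_one.indicator heK).comp continuous_polarCoord_symm.measurable
  rw [hv, ← lintegral_indicator_one heK, ← lintegral_comp_polarCoord_symm, polarCoord_target,
    Measure.volume_eq_prod, ← Measure.prod_restrict, lintegral_prod]
  · refine lintegral_congr fun r => ?_
    simp_rw [smul_eq_mul]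
    rw [lintegral_const_mul]
    · congr 1
      have hs : MeasurableSet (angleSlice K r) :=
        measurable_prodMk_left (measurableSet_prod_angleSlice hK)
      rw [← lintegral_indicator_one hs, ← lintegral_indicator measurableSet_Ioo]
      congr 1
      ext θ
      have hmem : polarCoord.symm (r, θ) ∈ e.symm ⁻¹' K ↔ polarPoint r θ ∈ K := by
        rw [Set.mem_preimage, hpolar]
      by_cases h1 : θ ∈ Set.Ioo (-Real.pi) Real.pi
      · rw [Set.indicator_of_mem h1]
        by_cases h2 : polarPoint r θ ∈ K
        · have h3 : θ ∈ angleSlice K r := ⟨h1, h2⟩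
          rw [Set.indicator_of_mem (hmem.2 h2), Set.indicator_of_mem h3]
          rfl
        · rw [Set.indicator_of_notMem (mt hmem.1 h2), Set.indicator_of_notMem fun h => h2 h.2]
      · rw [Set.indicator_of_notMem h1, Set.indicator_of_notMem fun h => h1 h.1]
    · exact hf.comp measurable_prodMk_left
  · exact ((measurable_fst.ennreal_ofReal).mul hf).aemeasurable

lemma mem_circSym_iff {R : ℝ} {K : Set (EuclideanSpace ℝ (Fin 2))} {p : EuclideanSpace ℝ (Fin 2)} :
    p ∈ circSym R K ↔ ‖p‖ ∈ Set.Icc 2 R ∧ (K ∩ Metric.sphere 0 ‖p‖).Nonempty ∧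
      ENNReal.ofReal (2 * ‖p‖ * |planeArg p|) ≤
        (Measure.hausdorffMeasure 1 : Measure (EuclideanSpace ℝ (Fin 2)))
          (K ∩ Metric.sphere 0 ‖p‖) := by
  constructor
  · rintro ⟨r, α, hr, hne, hle, h0, h1⟩
    have hr0 : 0 < r := by linarith [hr.1]
    obtain rfl : p = polarPoint r α := by
      ext i
      fin_cases i
      · exact h0
      · exact h1
    rw [norm_polarPoint hr0.le]
    refine ⟨hr, hne, le_trans (ENNReal.ofReal_le_ofReal ?_) hle⟩
    exact mul_le_mul_of_nonneg_left (abs_planeArg_polarPoint_le hr0 α) (by positivity)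
  · rintro ⟨hr, hne, hle⟩
    have h := polarPoint_norm_planeArg p
    exact ⟨‖p‖, planeArg p, hr, hne, hle, congrArg (fun x => x 0) h.symm,
      congrArg (fun x => x 1) h.symm⟩

lemma measurableSet_circSym {R : ℝ} {K : Set (EuclideanSpace ℝ (Fin 2))} (hK : IsCompact K) :
    MeasurableSet (circSym R K) := by
  have hset : circSym R K = (fun p => ‖p‖) ⁻¹' (Set.Icc 2 R ∩ norm '' K) ∩
      {p | ENNReal.ofReal (2 * ‖p‖ * |planeArg p|) ≤
        ENNReal.ofReal ‖p‖ * volume (angleSlice K ‖p‖)} := by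
    ext p
    rw [mem_circSym_iff]
    have hne : (K ∩ Metric.sphere 0 ‖p‖).Nonempty ↔ ‖p‖ ∈ norm '' K := by
      simp [Set.Nonempty]
    rw [hne]
    constructor
    · rintro ⟨h1, h2, h3⟩
      rw [hausdorffMeasure_inter_sphere hK.measurableSet (by linarith [h1.1])] at h3
      exact ⟨⟨h1, h2⟩, h3⟩
    · rintro ⟨⟨h1, h2⟩, h3⟩
      refine ⟨h1, h2, ?_⟩
      rwa [hausdorffMeasure_inter_sphere hK.measurableSet (by linarith [h1.1])]
  rw [hset]
  have hvol : Measurable fun r => volume (angleSlice K r) :=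
    measurable_measure_prodMk_left (measurableSet_prod_angleSlice hK.measurableSet)
  refine (measurable_norm (measurableSet_Icc.inter
    (hK.image continuous_norm).measurableSet)).inter (measurableSet_le ?_ ?_)
  · exact ((measurable_norm.const_mul 2).mul measurable_planeArg.abs).ennreal_ofReal
  · exact measurable_norm.ennreal_ofReal.mul (hvol.comp measurable_norm)

lemma volume_angleSlice_circSym {R : ℝ} {K : Set (EuclideanSpace ℝ (Fin 2))}
    (hK : MeasurableSet K) (hKR : ∀ x ∈ K, ‖x‖ ∈ Set.Icc 2 R) {r : ℝ} (hr : 0 < r) :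
    volume (angleSlice (circSym R K) r) = volume (angleSlice K r) := by
  by_cases hne : (K ∩ Metric.sphere 0 r).Nonempty
  · have hrR : r ∈ Set.Icc 2 R := by
      obtain ⟨x, hx, hxr⟩ := hne
      rw [mem_sphere_zero_iff_norm] at hxr
      exact hxr ▸ hKR x hx
    have hle : volume (angleSlice K r) ≤ ENNReal.ofReal (2 * Real.pi) := by
      refine (measure_mono (fun θ hθ => hθ.1 :
        angleSlice K r ⊆ Set.Ioo (-Real.pi) Real.pi)).trans ?_
      rw [Real.volume_Ioo]
      exact ENNReal.ofReal_le_ofReal (by linarith)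
    obtain ⟨v, hv0, hv⟩ : ∃ v : ℝ, 0 ≤ v ∧ volume (angleSlice K r) = ENNReal.ofReal v :=
      ⟨_, ENNReal.toReal_nonneg,
        (ENNReal.ofReal_toReal (ne_top_of_le_ne_top ENNReal.ofReal_ne_top hle)).symm⟩
    rw [hv, ENNReal.ofReal_le_ofReal_iff (by positivity)] at hle
    have hmem : ∀ θ ∈ Set.Ioo (-Real.pi) Real.pi, polarPoint r θ ∈ circSym R K ↔ |θ| ≤ v / 2 := by
      intro θ hθ
      rw [mem_circSym_iff, norm_polarPoint hr.le,
        planeArg_polarPoint hr (Set.Ioo_subset_Ioc_self hθ), hausdorffMeasure_inter_sphere hK hr,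
        hv, ← ENNReal.ofReal_mul hr.le, ENNReal.ofReal_le_ofReal_iff (by positivity)]
      rw [show 2 * r * |θ| = r * (2 * |θ|) by ring, mul_le_mul_iff_right₀ hr]
      constructor
      · rintro ⟨-, -, h⟩
        linarith
      · exact fun h => ⟨hrR, hne, by linarith⟩
    rw [hv]
    apply le_antisymm
    · have hsub : angleSlice (circSym R K) r ⊆ Set.Icc (-(v / 2)) (v / 2) := fun θ hθ =>
        abs_le.1 ((hmem θ hθ.1).1 hθ.2)
      refine (measure_mono hsub).trans ?_
      rw [Real.volume_Icc]
      exact ENNReal.ofReal_le_ofReal (by linarith)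
    · have hsub : Set.Ioo (-(v / 2)) (v / 2) ⊆ angleSlice (circSym R K) r := fun θ hθ => by
        have hθ' : θ ∈ Set.Ioo (-Real.pi) Real.pi := ⟨by linarith [hθ.1], by linarith [hθ.2]⟩
        exact ⟨hθ', (hmem θ hθ').2 (abs_le.2 ⟨hθ.1.le, hθ.2.le⟩)⟩
      refine le_trans ?_ (measure_mono hsub)
      rw [Real.volume_Ioo]
      exact ENNReal.ofReal_le_ofReal (by linarith)
  · have h1 : angleSlice K r = ∅ := Set.eq_empty_of_forall_notMem fun θ hθ =>
      hne ⟨_, hθ.2, by rw [mem_sphere_zero_iff_norm, norm_polarPoint hr.le]⟩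
    have h2 : angleSlice (circSym R K) r = ∅ := Set.eq_empty_of_forall_notMem fun θ hθ => by
      have h := (mem_circSym_iff.1 hθ.2).2.1
      rw [norm_polarPoint hr.le] at h
      exact hne h
    rw [h1, h2]

lemma volume_circSym {R : ℝ} {K : Set (EuclideanSpace ℝ (Fin 2))}
    (hK : IsCompact K) (hKR : ∀ x ∈ K, ‖x‖ ∈ Set.Icc 2 R) :
    volume (circSym R K) = volume K := by
  rw [volume_eq_lintegral_angleSlice (measurableSet_circSym hK),
    volume_eq_lintegral_angleSlice hK.measurableSet]
  refine setLIntegral_congr_fun measurableSet_Ioi fun r hr => ?_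
  rw [volume_angleSlice_circSym hK.measurableSet hKR hr]

/-- Two points at distance at most `2` from each other and at least `2` from the origin are seen
from the origin under an angle at most `π / 2`. -/
lemma exists_polarPoint_eq_of_dist_le {r φ : ℝ} {x : EuclideanSpace ℝ (Fin 2)} (hr : 2 ≤ r)
    (hx : 2 ≤ ‖x‖) (h : dist x (polarPoint r φ) ≤ 2) :
    ∃ t : ℝ, |t| ≤ Real.pi / 2 ∧ polarPoint ‖x‖ (φ + t) = x := by
  set t := toIocMod Real.two_pi_pos (-Real.pi) (planeArg x - φ) with ht
  have htx : polarPoint ‖x‖ (φ + t) = x := by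
    rw [ht, toIocMod, zsmul_eq_mul, ← add_sub_assoc, polarPoint_sub_int_mul_two_pi,
      add_sub_cancel, polarPoint_norm_planeArg]
  have htI : t ∈ Set.Ioc (-Real.pi) (-Real.pi + 2 * Real.pi) := toIocMod_mem_Ioc _ _ _
  have htpi : |t| ≤ Real.pi := abs_le.2 ⟨htI.1.le, by linarith [htI.2]⟩
  refine ⟨t, ?_, htx⟩
  by_contra! hlt
  have hcos : Real.cos t ≤ 0 := by
    rw [← Real.cos_abs]
    exact Real.cos_nonpos_of_pi_div_two_le_of_le hlt.le (by linarith [Real.pi_pos])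
  have hd := dist_polarPoint_sq ‖x‖ r (φ + t) φ
  rw [htx, add_sub_cancel_left] at hd
  have h2 : dist x (polarPoint r φ) ^ 2 ≤ 2 ^ 2 := by gcongr
  have h3 : ‖x‖ * r * Real.cos t ≤ 0 :=
    mul_nonpos_of_nonneg_of_nonpos (by positivity) hcos
  nlinarith

/-- A circular slice of `K` lies in an arc whose endpoints belong to `K`. -/
lemma exists_arc_of_inter_sphere {K : Set (EuclideanSpace ℝ (Fin 2))} (hK : IsClosed K) {r φ : ℝ}
    (hr : 0 < r)
    (hφ : ∀ x ∈ K, ∃ t : ℝ, |t| ≤ Real.pi / 2 ∧ polarPoint ‖x‖ (φ + t) = x)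
    (hne : (K ∩ Metric.sphere 0 r).Nonempty) :
    ∃ m M : ℝ, m ≤ M ∧ |m| ≤ Real.pi / 2 ∧ |M| ≤ Real.pi / 2 ∧ polarPoint r (φ + m) ∈ K ∧
      polarPoint r (φ + M) ∈ K ∧
      (Measure.hausdorffMeasure 1 : Measure (EuclideanSpace ℝ (Fin 2))) (K ∩ Metric.sphere 0 r) ≤
        ENNReal.ofReal (r * (M - m)) := by
  set T : Set ℝ := Set.Icc (-(Real.pi / 2)) (Real.pi / 2) ∩ (fun t => polarPoint r (φ + t)) ⁻¹' K
    with hT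
  have hcont : Continuous fun t => polarPoint r (φ + t) :=
    continuous_polarPoint.comp (f := fun t => (r, φ + t)) (by fun_prop)
  have hTc : IsCompact T := isCompact_Icc.inter_right (hK.preimage hcont)
  have hcover : ∀ x ∈ K ∩ Metric.sphere 0 r, ∃ t ∈ T, polarPoint r (φ + t) = x := by
    rintro x ⟨hx, hxr⟩
    rw [mem_sphere_zero_iff_norm] at hxr
    obtain ⟨t, ht, htx⟩ := hφ x hx
    rw [hxr] at htx
    exact ⟨t, ⟨abs_le.1 ht, by rwa [Set.mem_preimage, htx]⟩, htx⟩
  have hTne : T.Nonempty := by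
    obtain ⟨x, hx⟩ := hne
    obtain ⟨t, ht, -⟩ := hcover x hx
    exact ⟨t, ht⟩
  obtain ⟨m, hm, hmin⟩ := hTc.exists_isLeast hTne
  obtain ⟨M, hM, hmax⟩ := hTc.exists_isGreatest hTne
  refine ⟨m, M, hmin hM, abs_le.2 hm.1, abs_le.2 hM.1, hm.2, hM.2, ?_⟩
  have hsub : K ∩ Metric.sphere 0 r ⊆ polarPoint r '' Set.Icc (φ + m) (φ + M) := fun x hx => by
    obtain ⟨t, ht, rfl⟩ := hcover x hx
    exact ⟨φ + t, ⟨by linarith [hmin ht], by linarith [hmax ht]⟩, rfl⟩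
  refine (measure_mono hsub).trans ((hausdorffMeasure_image_polarPoint_le hr.le _).trans ?_)
  rw [Real.volume_Icc, ← ENNReal.ofReal_mul hr.le, add_sub_add_left_eq_sub]

lemma dist_polarPoint_le_dist_polarPoint {r s α β γ δ : ℝ} (hr : 0 ≤ r) (hs : 0 ≤ s)
    (h : |α - β| ≤ γ - δ) (hpi : γ - δ ≤ Real.pi) :
    dist (polarPoint r α) (polarPoint s β) ≤ dist (polarPoint r γ) (polarPoint s δ) := by
  rw [← sq_le_sq₀ dist_nonneg dist_nonneg, dist_polarPoint_sq, dist_polarPoint_sq]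
  have hcos := Real.cos_le_cos_of_nonneg_of_le_pi (abs_nonneg _) hpi h
  rw [Real.cos_abs] at hcos
  nlinarith [mul_le_mul_of_nonneg_left hcos (mul_nonneg hr hs)]

lemma dist_le_two_of_mem_circSym {R : ℝ} {K : Set (EuclideanSpace ℝ (Fin 2))} (hK : IsClosed K)
    (hKR : ∀ x ∈ K, 2 ≤ ‖x‖) (hdist : ∀ x ∈ K, ∀ y ∈ K, dist x y ≤ 2)
    {p q : EuclideanSpace ℝ (Fin 2)} (hp : p ∈ circSym R K) (hq : q ∈ circSym R K) :
    dist p q ≤ 2 := by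
  obtain ⟨hpR, hpne, hple⟩ := mem_circSym_iff.1 hp
  obtain ⟨hqR, hqne, hqle⟩ := mem_circSym_iff.1 hq
  have hp0 : 0 < ‖p‖ := by linarith [hpR.1]
  have hq0 : 0 < ‖q‖ := by linarith [hqR.1]
  obtain ⟨x₀, hx₀, -⟩ := id hpne
  have hφ : ∀ x ∈ K, ∃ t : ℝ, |t| ≤ Real.pi / 2 ∧ polarPoint ‖x‖ (planeArg x₀ + t) = x :=
    fun x hx => exists_polarPoint_eq_of_dist_le (hKR x₀ hx₀) (hKR x hx)
      (by rw [polarPoint_norm_planeArg]; exact hdist x hx x₀ hx₀)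
  have half : ∀ {r α m M : ℝ}, 0 < r → m ≤ M →
      ENNReal.ofReal (2 * r * |α|) ≤ ENNReal.ofReal (r * (M - m)) → 2 * |α| ≤ M - m := by
    intro r α m M hr hmM h
    rw [ENNReal.ofReal_le_ofReal_iff (mul_nonneg hr.le (sub_nonneg.2 hmM))] at h
    exact le_of_mul_le_mul_left (by linarith) hr
  obtain ⟨m, M, hmM, hm, hM, hmK, hMK, hH⟩ := exists_arc_of_inter_sphere hK hp0 hφ hpne
  obtain ⟨m', M', hmM', hm', hM', hmK', hMK', hH'⟩ := exists_arc_of_inter_sphere hK hq0 hφ hqne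
  have h1 := half hp0 hmM (hple.trans hH)
  have h2 := half hq0 hmM' (hqle.trans hH')
  have h3 : |planeArg p - planeArg q| ≤ |planeArg p| + |planeArg q| := abs_sub _ _
  rw [abs_le] at hm hM hm' hM'
  rw [← polarPoint_norm_planeArg p, ← polarPoint_norm_planeArg q]
  rcases le_total (M' - m) (M - m') with h | h
  · refine (dist_polarPoint_le_dist_polarPoint hp0.le hq0.le
      (γ := planeArg x₀ + M) (δ := planeArg x₀ + m') ?_ ?_).trans (hdist _ hMK _ hmK')
    · linarith
    · linarith
  · rw [dist_comm]
    rw [abs_sub_comm] at h3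
    refine (dist_polarPoint_le_dist_polarPoint hq0.le hp0.le
      (γ := planeArg x₀ + M') (δ := planeArg x₀ + m) ?_ ?_).trans (hdist _ hMK' _ hmK)
    · linarith
    · linarith

theorem stmt10 (R : ℝ) (hR : R ∈ Set.Ioc 2 4)
    (A : Set (EuclideanSpace ℝ (Fin 2))) (hA : IsCompact A)
    (hAD : A ⊆ {x : EuclideanSpace ℝ (Fin 2) | 2 ≤ ‖x‖ ∧ ‖x‖ ≤ R})
    (hdiam : EMetric.diam A ≤ 2) :
    EMetric.diam (circSym R A) ≤ 2 ∧ volume (circSym R A) = volume A := by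
  refine ⟨?_, volume_circSym hA hAD⟩
  have hdist : ∀ x ∈ A, ∀ y ∈ A, dist x y ≤ 2 := fun x hx y hy => by
    rw [← ENNReal.ofReal_le_ofReal_iff zero_le_two, ← edist_dist, ENNReal.ofReal_ofNat]
    exact (Metric.edist_le_ediam_of_mem hx hy).trans hdiam
  refine Metric.ediam_le fun p hp q hq => ?_
  rw [edist_dist]
  refine le_of_le_of_eq ?_ (ENNReal.ofReal_ofNat 2)
  exact ENNReal.ofReal_le_ofReal
    (dist_le_two_of_mem_circSym hA.isClosed (fun x hx => (hAD hx).1) hdist hp hq)
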